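/- Let n ≥ 2, α > 1, and let u : ℝⁿ → ℝ be continuously differentiable on an open ball B_{R₀} centered at the origin, with w_R(x) = (|x|/R)^α u(R x/|x|) satisfying ∫_{B_R} |∇u|² dx ≤ ∫_{B_R} |∇w_R|² dx for every R ∈ (0, R₀). Define A(R) = R^{-(n+2(α-1))} ∫_{B_R} |∇u|² dx − α ∫_{S^{n-1}} (u(Rθ)/R^α)² dθ. Then for every R ∈ (0, R₀) at which A is differentiable, A'(R) ≥ R^{-(1+2(α−1))} ∫_{S^{n-1}} ( ∂_ν u(Rθ) − α u(Rθ)/R )² dθ ≥ 0, where ∂_ν u(Rθ) = ∇u(Rθ)·θ. -/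

import Mathlib

open MeasureTheory Metric Set Filter
open scoped RealInnerProductSpace Topology Classical

noncomputable section

/-- Integral over the unit sphere `S^{n-1}` in `ℝⁿ` with its standard surface measure. -/
def sphInt (n : ℕ) (f : EuclideanSpace ℝ (Fin n) → ℝ) : ℝ :=
  ∫ θ : sphere (0 : EuclideanSpace ℝ (Fin n)) 1,
    f (θ : EuclideanSpace ℝ (Fin n)) ∂((volume : Measure (EuclideanSpace ℝ (Fin n))).toSphere)

/-- The Weiss-type monotonicity quantity
`A(R) = R^{-(n+2(α-1))} ∫_{B_R} |∇u|² - α ∫_{S^{n-1}} (u(Rθ)/R^α)²`. -/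
def Afun (n : ℕ) (α : ℝ) (u : EuclideanSpace ℝ (Fin n) → ℝ) (R : ℝ) : ℝ :=
  R ^ (-((n : ℝ) + 2 * (α - 1))) *
      (∫ x in ball (0 : EuclideanSpace ℝ (Fin n)) R, ‖gradient u x‖ ^ 2)
    - α * sphInt n (fun θ => (u (R • θ) / R ^ α) ^ 2)

/-- The α-homogeneous extension `w_R(x) = (|x|/R)^α u(R x/|x|)`, with `w_R 0 = 0`. -/
def homExt (n : ℕ) (α R : ℝ) (u : EuclideanSpace ℝ (Fin n) → ℝ)
    (x : EuclideanSpace ℝ (Fin n)) : ℝ :=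
  if x = 0 then 0 else (‖x‖ / R) ^ α * u ((R / ‖x‖) • x)

/-- The α-rescaling `u_R(x) = u(Rx)/R^α`. -/
def rescale (n : ℕ) (α : ℝ) (u : EuclideanSpace ℝ (Fin n) → ℝ) (R : ℝ)
    (x : EuclideanSpace ℝ (Fin n)) : ℝ :=
  u (R • x) / R ^ α

/-- Integration against `volumeIoiPow k` is integration on `(0, ∞)` with weight `r ^ k`. -/
lemma integral_volumeIoiPow (k : ℕ) (f : ℝ → ℝ) :
    ∫ r : Ioi (0 : ℝ), f r ∂(Measure.volumeIoiPow k) = ∫ r in Ioi (0 : ℝ), r ^ k * f r := by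
  simp only [Measure.volumeIoiPow, ENNReal.ofReal]
  rw [integral_withDensity_eq_integral_smul,
    integral_subtype_comap measurableSet_Ioi fun a ↦ Real.toNNReal (a ^ k) • f a]
  · refine setIntegral_congr_fun measurableSet_Ioi fun x hx ↦ ?_
    simp only [NNReal.smul_def, smul_eq_mul]
    rw [Real.coe_toNNReal _ (pow_nonneg hx.out.le _)]
  · exact (measurable_subtype_coe.pow_const _).real_toNNReal

/-- Polar coordinates, as an integral over the product of the sphere and the half-line. -/
lemma setIntegral_ball_eq_integral_prod {n : ℕ} (hn : 0 < n) (R : ℝ)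
    (g : EuclideanSpace ℝ (Fin n) → ℝ) :
    ∫ x in ball (0 : EuclideanSpace ℝ (Fin n)) R, g x =
      ∫ p : sphere (0 : EuclideanSpace ℝ (Fin n)) 1 × Ioi (0 : ℝ),
        (Iio R).indicator (fun s ↦ g (s • (p.1 : EuclideanSpace ℝ (Fin n)))) (p.2 : ℝ)
        ∂((volume : Measure (EuclideanSpace ℝ (Fin n))).toSphere.prod
          (Measure.volumeIoiPow (n - 1))) := by
  have : Nontrivial (EuclideanSpace ℝ (Fin n)) := by
    have : Nonempty (Fin n) := ⟨⟨0, hn⟩⟩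
    infer_instance
  have key := (volume : Measure (EuclideanSpace ℝ
    (Fin n))).measurePreserving_homeomorphUnitSphereProd.integral_comp
      (Homeomorph.measurableEmbedding _)
      (fun p ↦ (Iio R).indicator (fun s ↦ g (s • (p.1 : EuclideanSpace ℝ (Fin n)))) (p.2 : ℝ))
  rw [finrank_euclideanSpace_fin] at key
  rw [← key, ← integral_indicator measurableSet_ball]
  have hcompl : MeasurableSet ({0}ᶜ : Set (EuclideanSpace ℝ (Fin n))) :=
    (measurableSet_singleton _).compl
  have hsub := integral_subtype_comap (μ := volume) hcompl ((ball 0 R).indicator g)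
  rw [restrict_compl_singleton] at hsub
  rw [← hsub]
  refine integral_congr_ae (.of_forall fun x ↦ ?_)
  have hx : ‖(x : EuclideanSpace ℝ (Fin n))‖ ≠ 0 := norm_ne_zero_iff.2 x.2
  simp [indicator, smul_smul, hx]

/-- Polar coordinates on a ball for a continuous integrand. -/
lemma setIntegral_ball_eq_intervalIntegral {n : ℕ} (hn : 0 < n) {R : ℝ} (hR : 0 ≤ R)
    {g : EuclideanSpace ℝ (Fin n) → ℝ} (hg : ContinuousOn g (closedBall 0 R)) :
    ∫ x in ball (0 : EuclideanSpace ℝ (Fin n)) R, g x =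
      ∫ s in (0 : ℝ)..R, s ^ (n - 1) * sphInt n (fun θ ↦ g (s • θ)) := by
  have : Nontrivial (EuclideanSpace ℝ (Fin n)) := by
    have : Nonempty (Fin n) := ⟨⟨0, hn⟩⟩
    infer_instance
  have hint : Integrable (fun p : sphere (0 : EuclideanSpace ℝ (Fin n)) 1 × Ioi (0 : ℝ) ↦
      (Iio R).indicator (fun s ↦ g (s • (p.1 : EuclideanSpace ℝ (Fin n)))) (p.2 : ℝ))
      ((volume : Measure (EuclideanSpace ℝ (Fin n))).toSphere.prod
          (Measure.volumeIoiPow (n - 1))) := by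
    have key := (volume : Measure (EuclideanSpace ℝ
      (Fin n))).measurePreserving_homeomorphUnitSphereProd.integrable_comp_emb
        (Homeomorph.measurableEmbedding _)
        (g := fun p ↦ (Iio R).indicator
          (fun s ↦ g (s • (p.1 : EuclideanSpace ℝ (Fin n)))) (p.2 : ℝ))
    rw [finrank_euclideanSpace_fin] at key
    rw [← key]
    have h1 : Integrable ((ball (0 : EuclideanSpace ℝ (Fin n)) R).indicator g) := by
      rw [integrable_indicator_iff measurableSet_ball]
      exact (hg.integrableOn_compact (isCompact_closedBall 0 R)).mono_set ball_subset_closedBall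
    have h2 := (integrableOn_iff_comap_subtypeVal
      (measurableSet_singleton (0 : EuclideanSpace ℝ (Fin n))).compl).1 h1.integrableOn
    refine h2.congr (.of_forall fun x ↦ ?_)
    have hx : ‖(x : EuclideanSpace ℝ (Fin n))‖ ≠ 0 := norm_ne_zero_iff.2 x.2
    simp [indicator, smul_smul, hx]
  rw [setIntegral_ball_eq_integral_prod hn, integral_prod_symm _ hint]
  rw [integral_volumeIoiPow (n - 1) (fun s ↦ ∫ θ : sphere (0 : EuclideanSpace ℝ (Fin n)) 1,
    (Iio R).indicator (fun s ↦ g (s • (θ : EuclideanSpace ℝ (Fin n)))) s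
      ∂(volume : Measure (EuclideanSpace ℝ (Fin n))).toSphere)]
  rw [intervalIntegral.integral_of_le hR, integral_Ioc_eq_integral_Ioo, ← Ioi_inter_Iio,
    ← setIntegral_indicator measurableSet_Iio]
  refine integral_congr_ae (.of_forall fun s ↦ ?_)
  by_cases hs : s < R <;> simp [sphInt, indicator, hs]

/-- Polar coordinates on a ball for a positively homogeneous integrand. -/
lemma setIntegral_ball_of_homogeneous {n : ℕ} (hn : 0 < n) {R p : ℝ} (hR : 0 ≤ R) (hp : 0 ≤ p)
    {g h : EuclideanSpace ℝ (Fin n) → ℝ}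
    (hg : ∀ s ∈ Ioo 0 R, ∀ θ ∈ sphere (0 : EuclideanSpace ℝ (Fin n)) 1,
      g (s • θ) = s ^ p * h θ) :
    ∫ x in ball (0 : EuclideanSpace ℝ (Fin n)) R, g x =
      R ^ (n + p) / (n + p) * sphInt n h := by
  have hn' : (1 : ℝ) ≤ n := by exact_mod_cast hn
  have hpow : ∫ s : Ioi (0 : ℝ), (Iio R).indicator (fun s ↦ s ^ p) (s : ℝ)
      ∂(Measure.volumeIoiPow (n - 1)) = R ^ (n + p) / (n + p) := by
    rw [integral_volumeIoiPow (n - 1) ((Iio R).indicator (fun s ↦ s ^ p))]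
    have h1 : ∫ s in (0 : ℝ)..R, s ^ (n - 1 + p) = R ^ (n + p) / (n + p) := by
      rw [integral_rpow (.inl (by linarith)), Real.zero_rpow (by linarith)]
      ring_nf
    rw [← h1, intervalIntegral.integral_of_le hR, integral_Ioc_eq_integral_Ioo, ← Ioi_inter_Iio,
      ← setIntegral_indicator measurableSet_Iio]
    refine setIntegral_congr_fun measurableSet_Ioi fun s hs ↦ ?_
    by_cases hsR : s < R
    · simp only [indicator, mem_Iio, hsR, if_true]
      rw [Real.rpow_add hs, ← Real.rpow_natCast, Nat.cast_pred hn]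
    · simp [indicator, hsR]
  rw [setIntegral_ball_eq_integral_prod hn, ← hpow, mul_comm, sphInt, ← integral_prod_mul
    (fun θ : sphere (0 : EuclideanSpace ℝ (Fin n)) 1 ↦ h (θ : EuclideanSpace ℝ (Fin n)))
    (fun s : Ioi (0 : ℝ) ↦ (Iio R).indicator (fun s ↦ s ^ p) (s : ℝ))]
  refine integral_congr_ae (.of_forall fun x ↦ ?_)
  by_cases hx : (x.2 : ℝ) < R
  · simp only [indicator, mem_Iio, hx, if_true]
    rw [hg _ ⟨x.2.2, hx⟩ _ x.1.2, mul_comm]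
  · simp [indicator, hx]

/-- The gradient of the homogeneous extension along a ray. -/
lemma hasGradientAt_homExt {n : ℕ} {α R r : ℝ} {u : EuclideanSpace ℝ (Fin n) → ℝ}
    {θ : EuclideanSpace ℝ (Fin n)} (hθ : ‖θ‖ = 1) (hr : 0 < r) (hR : 0 < R)
    (hu : DifferentiableAt ℝ u (R • θ)) :
    HasGradientAt (homExt n α R u)
      ((r / R) ^ (α - 1) • ((α / R * u (R • θ)) • θ + gradient u (R • θ)
        - ⟪gradient u (R • θ), θ⟫ • θ)) (r • θ) := by
  have hnorm : ‖r • θ‖ = r := by rw [norm_smul, hθ, mul_one, Real.norm_of_nonneg hr.le]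
  have hx : r • θ ≠ 0 := norm_ne_zero_iff.1 (by rw [hnorm]; exact hr.ne')
  have hdn : HasFDerivAt (fun y : EuclideanSpace ℝ (Fin n) ↦ ‖y‖) (innerSL ℝ θ) (r • θ) := by
    have h := ((hasStrictFDerivAt_norm_sq (r • θ)).hasFDerivAt).sqrt (by simp [hx])
    simp only [Real.sqrt_sq (norm_nonneg _)] at h
    refine h.congr_fderiv ?_
    ext v
    simp [hnorm]
    field_simp
  have hpow : HasFDerivAt (fun y : EuclideanSpace ℝ (Fin n) ↦ (‖y‖ / R) ^ α)
      ((α * (r / R) ^ (α - 1) / R) • innerSL ℝ θ) (r • θ) := by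
    have h1 : HasDerivAt (fun t : ℝ ↦ (t / R) ^ α) (1 / R * α * (r / R) ^ (α - 1)) ‖r • θ‖ := by
      rw [hnorm]
      exact ((hasDerivAt_id r).div_const R).rpow_const (.inl (div_pos hr hR).ne')
    refine (h1.comp_hasFDerivAt _ hdn).congr_fderiv ?_
    congr 1
    ring
  have hproj : HasFDerivAt (fun y : EuclideanSpace ℝ (Fin n) ↦ (R / ‖y‖) • y)
      ((R / r) • (ContinuousLinearMap.id ℝ _ - (innerSL ℝ θ).smulRight θ)) (r • θ) := by
    have h1 : HasDerivAt (fun t : ℝ ↦ R / t) (-(R / r ^ 2)) ‖r • θ‖ := by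
      rw [hnorm]
      simpa [div_eq_mul_inv] using (hasDerivAt_inv hr.ne').const_mul R
    refine ((h1.comp_hasFDerivAt _ hdn).smul (hasFDerivAt_id (r • θ))).congr_fderiv ?_
    ext1 v
    simp [hnorm, smul_smul, sub_eq_add_neg]
    field_simp
  have hRr : (R / ‖r • θ‖) • r • θ = R • θ := by
    rw [hnorm, smul_smul, div_mul_cancel₀ _ hr.ne']
  have hu' : HasFDerivAt (fun y : EuclideanSpace ℝ (Fin n) ↦ u ((R / ‖y‖) • y)) _ (r • θ) :=
    HasFDerivAt.comp (g := u) (g' := fderiv ℝ u (R • θ)) (r • θ)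
      (by rw [hRr]; exact hu.hasFDerivAt) hproj
  rw [hasGradientAt_iff_hasFDerivAt]
  refine ((hpow.mul hu').congr_fderiv ?_).congr_of_eventuallyEq ?_
  · ext v
    rw [hRr, hnorm]
    have h1 : (r / R) ^ α = (r / R) ^ (α - 1) * (r / R) := by
      rw [Real.rpow_sub_one (div_pos hr hR).ne', div_mul_cancel₀ _ (div_pos hr hR).ne']
    have h2 : ∀ w, fderiv ℝ u (R • θ) w = ⟪gradient u (R • θ), w⟫ := fun w ↦
      inner_gradient_left.symm
    simp [inner_smul_right, h1, h2, -inner_gradient_left]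
    field_simp
    ring
  · filter_upwards [isOpen_ne.mem_nhds hx] with y hy
    simp only [homExt, if_neg hy, Pi.mul_apply]

lemma norm_gradient_homExt_sq {n : ℕ} {α R r : ℝ} {u : EuclideanSpace ℝ (Fin n) → ℝ}
    {θ : EuclideanSpace ℝ (Fin n)} (hθ : ‖θ‖ = 1) (hr : 0 < r) (hR : 0 < R)
    (hu : DifferentiableAt ℝ u (R • θ)) :
    ‖gradient (homExt n α R u) (r • θ)‖ ^ 2 = r ^ (2 * (α - 1)) * (R ^ (-(2 * (α - 1))) *
      ((α / R * u (R • θ)) ^ 2 + ‖gradient u (R • θ)‖ ^ 2 - ⟪gradient u (R • θ), θ⟫ ^ 2)) := by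
  rw [(hasGradientAt_homExt hθ hr hR hu).gradient, norm_smul, mul_pow, Real.norm_eq_abs, sq_abs,
    ← mul_assoc, Real.rpow_neg hR.le, ← div_eq_mul_inv, ← Real.div_rpow hr.le hR.le,
    mul_comm 2, Real.rpow_mul (div_pos hr hR).le, Real.rpow_two]
  congr 1
  have hθ2 : ⟪θ, θ⟫ = (1 : ℝ) := by rw [real_inner_self_eq_norm_sq, hθ, one_pow]
  rw [← real_inner_self_eq_norm_sq, ← real_inner_self_eq_norm_sq]
  simp only [inner_sub_left, inner_sub_right, inner_add_left, inner_add_right, inner_smul_left,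
    inner_smul_right, hθ2, real_inner_comm θ (gradient u (R • θ)), conj_trivial]
  ring

lemma integrable_sphere_of_continuousOn {n : ℕ} {f : EuclideanSpace ℝ (Fin n) → ℝ}
    (hf : ContinuousOn f (sphere 0 1)) :
    Integrable (fun θ : sphere (0 : EuclideanSpace ℝ (Fin n)) 1 ↦ f θ)
      (volume : Measure (EuclideanSpace ℝ (Fin n))).toSphere :=
  (continuousOn_iff_continuous_domRestrict.1 hf).integrable_of_hasCompactSupport
    (HasCompactSupport.of_compactSpace _)

lemma smul_mem_ball_zero {n : ℕ} {s ρ : ℝ} {θ : EuclideanSpace ℝ (Fin n)}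
    (hθ : θ ∈ sphere (0 : EuclideanSpace ℝ (Fin n)) 1) (hs : |s| < ρ) :
    s • θ ∈ ball (0 : EuclideanSpace ℝ (Fin n)) ρ := by
  rw [mem_sphere_zero_iff_norm] at hθ
  simpa [norm_smul, hθ] using hs

/-- Spherical means of a continuous function depend continuously on the radius. -/
lemma continuousOn_sphInt {n : ℕ} {ρ : ℝ} {g : EuclideanSpace ℝ (Fin n) → ℝ}
    (hg : ContinuousOn g (ball 0 ρ)) :
    ContinuousOn (fun s : ℝ ↦ sphInt n (fun θ ↦ g (s • θ))) (Ioo (-ρ) ρ) := by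
  intro s hs
  obtain ⟨t, hst, htρ⟩ := exists_between (abs_lt.2 hs)
  obtain ⟨C, hC⟩ :=
    (isCompact_closedBall (0 : EuclideanSpace ℝ (Fin n)) t).exists_bound_of_continuousOn
      (hg.mono (closedBall_subset_ball htρ))
  refine ContinuousAt.continuousWithinAt ?_
  have hnhds : Ioo (-t) t ∈ 𝓝 s := isOpen_Ioo.mem_nhds (abs_lt.1 hst)
  refine ContinuousOn.continuousAt (s := Ioo (-t) t) ?_ hnhds
  refine continuousOn_of_dominated (bound := fun _ ↦ C) (fun x hx ↦ ?_) (fun x hx ↦ ?_)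
    (integrable_const C) ?_
  · refine (integrable_sphere_of_continuousOn (f := fun θ ↦ g (x • θ)) ?_).aestronglyMeasurable
    exact hg.comp (by fun_prop) fun θ hθ ↦ smul_mem_ball_zero hθ ((abs_lt.2 hx).trans htρ)
  · refine .of_forall fun θ ↦ hC _ (ball_subset_closedBall ?_)
    exact smul_mem_ball_zero θ.2 (abs_lt.2 hx)
  · refine .of_forall fun θ ↦ hg.comp (by fun_prop) fun x hx ↦ ?_
    exact smul_mem_ball_zero θ.2 ((abs_lt.2 hx).trans htρ)

/-- Differentiation of a spherical mean with respect to the radius. -/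
lemma hasDerivAt_sphInt {n : ℕ} {ρ R : ℝ} {g : EuclideanSpace ℝ (Fin n) → ℝ}
    {g' : EuclideanSpace ℝ (Fin n) → EuclideanSpace ℝ (Fin n)}
    (hg : ∀ x ∈ ball 0 ρ, HasGradientAt g (g' x) x) (hg' : ContinuousOn g' (ball 0 ρ))
    (hR : |R| < ρ) :
    HasDerivAt (fun s : ℝ ↦ sphInt n (fun θ ↦ g (s • θ)))
      (sphInt n (fun θ ↦ ⟪g' (R • θ), θ⟫)) R := by
  obtain ⟨t, hRt, htρ⟩ := exists_between hR
  obtain ⟨C, hC⟩ :=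
    (isCompact_closedBall (0 : EuclideanSpace ℝ (Fin n)) t).exists_bound_of_continuousOn
      (hg'.mono (closedBall_subset_ball htρ))
  have hnhds : Ioo (-t) t ∈ 𝓝 R := isOpen_Ioo.mem_nhds (abs_lt.1 hRt)
  have hgc : ContinuousOn g (ball 0 ρ) := fun x hx ↦
    (hg x hx).differentiableAt.continuousAt.continuousWithinAt
  have hmaps : ∀ x ∈ Ioo (-t) t, MapsTo (fun θ : EuclideanSpace ℝ (Fin n) ↦ x • θ) (sphere 0 1)
      (ball 0 ρ) := fun x hx θ hθ ↦ smul_mem_ball_zero hθ ((abs_lt.2 hx).trans htρ)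
  have hF : ∀ x ∈ Ioo (-t) t, Integrable
      (fun θ : sphere (0 : EuclideanSpace ℝ (Fin n)) 1 ↦ g (x • (θ : EuclideanSpace ℝ (Fin n))))
      (volume : Measure (EuclideanSpace ℝ (Fin n))).toSphere := fun x hx ↦
    integrable_sphere_of_continuousOn (f := fun θ ↦ g (x • θ))
      (hgc.comp (by fun_prop) (hmaps x hx))
  refine (hasDerivAt_integral_of_dominated_loc_of_deriv_le
    (F := fun s (θ : sphere (0 : EuclideanSpace ℝ (Fin n)) 1) ↦
      g (s • (θ : EuclideanSpace ℝ (Fin n))))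
    (F' := fun s θ ↦ ⟪g' (s • (θ : EuclideanSpace ℝ (Fin n))), (θ : EuclideanSpace ℝ (Fin n))⟫)
    (bound := fun _ ↦ C) hnhds
    (by filter_upwards [hnhds] with x hx using (hF x hx).aestronglyMeasurable)
    (hF R (mem_of_mem_nhds hnhds)) ?_ ?_ (integrable_const C) ?_).2
  · refine (integrable_sphere_of_continuousOn
      (f := fun θ ↦ ⟪g' (R • θ), θ⟫) ?_).aestronglyMeasurable
    exact (hg'.comp (by fun_prop) (hmaps R (mem_of_mem_nhds hnhds))).inner continuousOn_id
  · refine .of_forall fun θ x hx ↦ (norm_inner_le_norm _ _).trans ?_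
    rw [mem_sphere_zero_iff_norm.1 θ.2, mul_one]
    exact hC _ (ball_subset_closedBall (smul_mem_ball_zero θ.2 (abs_lt.2 hx)))
  · refine .of_forall fun θ x hx ↦ ?_
    have h1 := (hg _ (hmaps x hx θ.2)).hasFDerivAt.comp_hasDerivAt x
      ((hasDerivAt_id x).smul_const (θ : EuclideanSpace ℝ (Fin n)))
    simpa [Function.comp_def] using h1

/-- wherever `A` is differentiable,
`A'(R) ≥ R^{-(1+2(α-1))} ∫_{S^{n-1}} (∂_ν u(Rθ) - α u(Rθ)/R)² dθ ≥ 0`. -/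
theorem deriv_A_lower_bound {n : ℕ} (hn : 2 ≤ n) {α R₀ : ℝ} (hα : 1 < α) (hR₀ : 0 < R₀)
    (u : EuclideanSpace ℝ (Fin n) → ℝ)
    (hu : ContDiffOn ℝ 1 u (ball (0 : EuclideanSpace ℝ (Fin n)) R₀))
    (hmin : ∀ R ∈ Set.Ioo (0 : ℝ) R₀,
      (∫ x in ball (0 : EuclideanSpace ℝ (Fin n)) R, ‖gradient u x‖ ^ 2) ≤
        ∫ x in ball (0 : EuclideanSpace ℝ (Fin n)) R, ‖gradient (homExt n α R u) x‖ ^ 2) :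
    ∀ R ∈ Set.Ioo (0 : ℝ) R₀, DifferentiableAt ℝ (Afun n α u) R →
      R ^ (-(1 + 2 * (α - 1))) * sphInt n (fun θ =>
          (⟪gradient u (R • θ), θ⟫ - α * u (R • θ) / R) ^ 2) ≤ deriv (Afun n α u) R ∧
      0 ≤ R ^ (-(1 + 2 * (α - 1))) * sphInt n (fun θ =>
          (⟪gradient u (R • θ), θ⟫ - α * u (R • θ) / R) ^ 2) := by
  have hn0 : 0 < n := by omega
  intro R hR
  obtain ⟨hR0, hRR⟩ := hR
  have hRabs : |R| < R₀ := by rwa [abs_of_pos hR0]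
  have hdiff : ∀ x ∈ ball (0 : EuclideanSpace ℝ (Fin n)) R₀, DifferentiableAt ℝ u x :=
    fun x hx ↦ (hu.differentiableOn one_ne_zero).differentiableAt (isOpen_ball.mem_nhds hx)
  have hgrad : ContinuousOn (gradient u) (ball 0 R₀) :=
    (InnerProductSpace.toDual ℝ _).symm.continuous.comp_continuousOn
      (hu.continuousOn_fderiv_of_isOpen isOpen_ball le_rfl)
  have hgradsq : ContinuousOn (fun x ↦ ‖gradient u x‖ ^ 2) (ball 0 R₀) := hgrad.norm.pow 2
  have hmaps : MapsTo (fun θ : EuclideanSpace ℝ (Fin n) ↦ R • θ) (sphere 0 1) (ball 0 R₀) :=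
    fun θ hθ ↦ smul_mem_ball_zero hθ hRabs
  have hcu : ContinuousOn (fun θ ↦ u (R • θ)) (sphere (0 : EuclideanSpace ℝ (Fin n)) 1) :=
    hu.continuousOn.comp (by fun_prop) hmaps
  have hcg : ContinuousOn (fun θ ↦ gradient u (R • θ))
      (sphere (0 : EuclideanSpace ℝ (Fin n)) 1) := hgrad.comp (by fun_prop) hmaps
  have hcν : ContinuousOn (fun θ ↦ ⟪gradient u (R • θ), θ⟫)
      (sphere (0 : EuclideanSpace ℝ (Fin n)) 1) := hcg.inner continuousOn_id
  have hIuu := integrable_sphere_of_continuousOn (f := fun θ ↦ u (R • θ) ^ 2)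
    (hcu.pow 2)
  have hIuν := integrable_sphere_of_continuousOn
    (f := fun θ ↦ u (R • θ) * ⟪gradient u (R • θ), θ⟫) (hcu.mul hcν)
  have hIνν := integrable_sphere_of_continuousOn
    (f := fun θ ↦ ⟪gradient u (R • θ), θ⟫ ^ 2) (hcν.pow 2)
  have hIgg := integrable_sphere_of_continuousOn
    (f := fun θ ↦ ‖gradient u (R • θ)‖ ^ 2) (hcg.norm.pow 2)
  set Suu := sphInt n (fun θ ↦ u (R • θ) ^ 2) with hSuu
  set Suν := sphInt n (fun θ ↦ u (R • θ) * ⟪gradient u (R • θ), θ⟫) with hSuν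
  set Sνν := sphInt n (fun θ ↦ ⟪gradient u (R • θ), θ⟫ ^ 2) with hSνν
  set Sgg := sphInt n (fun θ ↦ ‖gradient u (R • θ)‖ ^ 2) with hSgg
  have hsq : sphInt n (fun θ ↦ (⟪gradient u (R • θ), θ⟫ - α * u (R • θ) / R) ^ 2) =
      Sνν - 2 * α / R * Suν + α ^ 2 / R ^ 2 * Suu := by
    simp only [hSuu, hSuν, hSνν, sphInt]
    rw [← integral_const_mul, ← integral_const_mul,
      ← integral_sub hIνν (hIuν.const_mul _), ← integral_add (hIνν.sub' (hIuν.const_mul _))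
        (hIuu.const_mul _)]
    refine integral_congr_ae (.of_forall fun θ ↦ ?_)
    simp only
    ring
  have hw : sphInt n (fun θ ↦ R ^ (-(2 * (α - 1))) * ((α / R * u (R • θ)) ^ 2
      + ‖gradient u (R • θ)‖ ^ 2 - ⟪gradient u (R • θ), θ⟫ ^ 2)) =
      R ^ (-(2 * (α - 1))) * (α ^ 2 / R ^ 2 * Suu + Sgg - Sνν) := by
    simp only [hSuu, hSgg, hSνν, sphInt]
    rw [integral_const_mul, ← integral_const_mul (α ^ 2 / R ^ 2),
      ← integral_add (hIuu.const_mul _) hIgg,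
      ← integral_sub ((hIuu.const_mul _).fun_add hIgg) hIνν]
    congr 1
    refine integral_congr_ae (.of_forall fun θ ↦ ?_)
    simp only
    ring
  have hnonneg : 0 ≤ R ^ (-(1 + 2 * (α - 1))) * sphInt n (fun θ =>
      (⟪gradient u (R • θ), θ⟫ - α * u (R • θ) / R) ^ 2) :=
    mul_nonneg (Real.rpow_nonneg hR0.le _) (integral_nonneg fun θ ↦ sq_nonneg _)
  intro _
  refine ⟨?_, hnonneg⟩
  set β : ℝ := n + 2 * (α - 1) with hβ
  have hβ0 : 0 < β := add_pos_of_nonneg_of_pos n.cast_nonneg (by linarith)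
  set D : ℝ := ∫ x in ball (0 : EuclideanSpace ℝ (Fin n)) R, ‖gradient u x‖ ^ 2 with hD
  have hcomp : D ≤ R ^ β / β * (R ^ (-(2 * (α - 1))) * (α ^ 2 / R ^ 2 * Suu + Sgg - Sνν)) := by
    refine (hmin R ⟨hR0, hRR⟩).trans_eq ?_
    rw [← hw]
    refine setIntegral_ball_of_homogeneous hn0 hR0.le (by linarith) fun s hs θ hθ ↦ ?_
    exact norm_gradient_homExt_sq (mem_sphere_zero_iff_norm.1 hθ) hs.1 hR0 (hdiff _ (hmaps hθ))
  have hpolar : ∀ s ∈ Ioo 0 R₀, ∫ x in ball (0 : EuclideanSpace ℝ (Fin n)) s, ‖gradient u x‖ ^ 2 =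
      ∫ t in (0 : ℝ)..s, t ^ (n - 1) * sphInt n (fun θ ↦ ‖gradient u (t • θ)‖ ^ 2) :=
    fun s hs ↦ setIntegral_ball_eq_intervalIntegral hn0 hs.1.le
      (hgradsq.mono (closedBall_subset_ball hs.2))
  have hnhds : Ioo 0 R₀ ∈ 𝓝 R := isOpen_Ioo.mem_nhds ⟨hR0, hRR⟩
  have hradial : ContinuousOn
      (fun t : ℝ ↦ t ^ (n - 1) * sphInt n (fun θ ↦ ‖gradient u (t • θ)‖ ^ 2)) (Ioo (-R₀) R₀) :=
    (by fun_prop : ContinuousOn (fun t : ℝ ↦ t ^ (n - 1)) _).mul (continuousOn_sphInt hgradsq)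
  have hderD : HasDerivAt
      (fun s ↦ ∫ x in ball (0 : EuclideanSpace ℝ (Fin n)) s, ‖gradient u x‖ ^ 2)
      (R ^ (n - 1) * Sgg) R := by
    have hRmem : Ioo (-R₀) R₀ ∈ 𝓝 R := isOpen_Ioo.mem_nhds (abs_lt.1 hRabs)
    refine (intervalIntegral.integral_hasDerivAt_right (a := 0) ?_
      (hradial.stronglyMeasurableAtFilter isOpen_Ioo R (mem_of_mem_nhds hRmem))
      (hradial.continuousAt hRmem)).congr_of_eventuallyEq ?_
    · refine (hradial.mono ?_).intervalIntegrable
      rw [uIcc_of_le hR0.le]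
      exact fun t ht ↦ ⟨by linarith [ht.1], ht.2.trans_lt hRR⟩
    · filter_upwards [hnhds] with s hs using hpolar s hs
  have hderS : HasDerivAt (fun s ↦ sphInt n (fun θ ↦ u (s • θ) ^ 2)) (2 * Suν) R := by
    have h := hasDerivAt_sphInt (g := fun x ↦ u x ^ 2)
      (g' := fun x ↦ (2 * u x) • gradient u x) (ρ := R₀) (R := R) (fun x hx ↦ ?_)
      ((continuousOn_const.mul hu.continuousOn).smul hgrad) hRabs
    · convert h using 1
      simp only [hSuν, sphInt, ← integral_const_mul, inner_smul_left, conj_trivial, mul_assoc]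
    · rw [hasGradientAt_iff_hasFDerivAt]
      refine ((hdiff x hx).hasFDerivAt.pow 2).congr_fderiv ?_
      ext v
      simp
  have hderA : HasDerivAt (Afun n α u) ((-β * R ^ (-β - 1)) * D + R ^ (-β) * (R ^ (n - 1) * Sgg)
      - α * ((-(2 * α) * R ^ (-(2 * α) - 1)) * Suu + R ^ (-(2 * α)) * (2 * Suν))) R := by
    refine (((Real.hasDerivAt_rpow_const (.inl hR0.ne')).mul hderD).sub
      (((Real.hasDerivAt_rpow_const (.inl hR0.ne')).mul hderS).const_mul
        α)).congr_of_eventuallyEq ?_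
    filter_upwards [hnhds] with s hs
    simp only [Afun, Pi.mul_apply, Pi.sub_apply]
    congr 2
    simp only [sphInt, ← integral_const_mul]
    refine integral_congr_ae (.of_forall fun θ ↦ ?_)
    simp only
    rw [div_pow, ← Real.rpow_mul_natCast hs.1.le, Real.rpow_neg hs.1.le, mul_comm α,
      Nat.cast_ofNat, div_eq_inv_mul]
  rw [hderA.deriv, hsq]
  have e1 : R ^ (-β - 1) * R ^ β = R⁻¹ := by
    rw [← Real.rpow_add hR0, ← Real.rpow_neg_one]
    ring_nf
  have e2 : R ^ (-(2 * (α - 1))) = R ^ (-(2 * α)) * R ^ 2 := by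
    rw [← Real.rpow_natCast, ← Real.rpow_add hR0]
    push_cast
    ring_nf
  have e3 : R ^ (-β) * R ^ (n - 1) = R ^ (-(2 * α)) * R := by
    rw [← Real.rpow_natCast, ← Real.rpow_add hR0, ← Real.rpow_add_one hR0.ne', Nat.cast_pred hn0,
      hβ]
    ring_nf
  have e4 : R ^ (-(2 * α) - 1) = R ^ (-(2 * α)) * R⁻¹ := by
    rw [Real.rpow_sub_one hR0.ne', div_eq_mul_inv]
  have e5 : R ^ (-(1 + 2 * (α - 1))) = R ^ (-(2 * α)) * R := by
    rw [← Real.rpow_add_one hR0.ne']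
    ring_nf
  have hscaled : β * R ^ (-β - 1) * D ≤
      R⁻¹ * (R ^ (-(2 * α)) * R ^ 2 * (α ^ 2 / R ^ 2 * Suu + Sgg - Sνν)) := by
    refine (mul_le_mul_of_nonneg_left hcomp (by positivity)).trans_eq ?_
    rw [← e2, ← e1]
    field_simp
  rw [e5, e4, ← mul_assoc (R ^ (-β)), e3]
  calc _ = -(R⁻¹ * (R ^ (-(2 * α)) * R ^ 2 * (α ^ 2 / R ^ 2 * Suu + Sgg - Sνν)))
        + R ^ (-(2 * α)) * R * Sgg - α * (-(2 * α) * (R ^ (-(2 * α)) * R⁻¹) * Suu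
          + R ^ (-(2 * α)) * (2 * Suν)) := by
        field_simp
        ring
    _ ≤ _ := by linarith
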